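/- arXiv:1309.1656 — 2 statements merged into one kernel-verified Lean document; each statement's English description precedes it below -/
import Mathlib

section
/- (H-theorem for the matrix-valued BGK collision operator.) Fix d ≥ 1, τ > 0, and let W, W_eq : ℝ^d → ℂ^{2×2} be measurable functions whose values are Hermitian matrices with all eigenvalues in (0,1), such that p ↦ tr[(h'(W(p)) − h'(W_eq(p)))(W_eq(p) − W(p))] is integrable, where h'(x) = log(1−x) − log(x) acts via continuous functional calculus. Then the entropy production σ = (1/τ) ∫_{ℝ^d} tr[(h'(W(p)) − h'(W_eq(p)))(W_eq(p) − W(p))] dp satisfies σ ≥ 0, and σ = 0 if and only if W(p) = W_eq(p) for almost every p. -/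
open Matrix MeasureTheory
open scoped ComplexOrder

/-- Functional calculus for Hermitian matrices: apply the real function `f` to the
eigenvalues in an orthonormal eigenbasis (and return `0` on non-Hermitian input). -/
noncomputable def matFun {n : ℕ} (f : ℝ → ℝ) (A : Matrix (Fin n) (Fin n) ℂ) :
    Matrix (Fin n) (Fin n) ℂ :=
  if hA : A.IsHermitian then
    (hA.eigenvectorUnitary : Matrix (Fin n) (Fin n) ℂ) *
      Matrix.diagonal (fun i => (f (hA.eigenvalues i) : ℂ)) *
      star (hA.eigenvectorUnitary : Matrix (Fin n) (Fin n) ℂ)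
  else 0

/-- The matrix of inner products between the eigenvectors of `A` and those of `B`. -/
noncomputable def eigenOverlap {n : ℕ} {A B : Matrix (Fin n) (Fin n) ℂ}
    (hA : A.IsHermitian) (hB : B.IsHermitian) : Matrix (Fin n) (Fin n) ℂ :=
  star (hA.eigenvectorUnitary : Matrix (Fin n) (Fin n) ℂ) *
    (hB.eigenvectorUnitary : Matrix (Fin n) (Fin n) ℂ)

theorem matFun_id {n : ℕ} {A : Matrix (Fin n) (Fin n) ℂ} (hA : A.IsHermitian) :
    matFun (fun x => x) A = A := by
  conv_rhs => rw [hA.spectral_theorem]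
  rw [matFun, dif_pos hA]
  rfl

/-- In the eigenbases of `A` and `B`, the matrix `f(A) - g(B)` has entries
`f(aᵢ) - g(bⱼ)` times the eigenvector overlaps. -/
theorem star_mul_matFun_sub_mul {n : ℕ} (f g : ℝ → ℝ) {A B : Matrix (Fin n) (Fin n) ℂ}
    (hA : A.IsHermitian) (hB : B.IsHermitian) :
    star (hA.eigenvectorUnitary : Matrix (Fin n) (Fin n) ℂ) * (matFun f A - matFun g B) *
        (hB.eigenvectorUnitary : Matrix (Fin n) (Fin n) ℂ) =
      Matrix.of fun i j =>
        ((f (hA.eigenvalues i) : ℂ) - g (hB.eigenvalues j)) * eigenOverlap hA hB i j := by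
  have hU := Unitary.coe_star_mul_self hA.eigenvectorUnitary
  have hV := Unitary.coe_star_mul_self hB.eigenvectorUnitary
  have key : star (hA.eigenvectorUnitary : Matrix (Fin n) (Fin n) ℂ) *
        (matFun f A - matFun g B) * (hB.eigenvectorUnitary : Matrix (Fin n) (Fin n) ℂ) =
      Matrix.diagonal (fun i => (f (hA.eigenvalues i) : ℂ)) * eigenOverlap hA hB -
        eigenOverlap hA hB * Matrix.diagonal (fun i => (g (hB.eigenvalues i) : ℂ)) := by
    rw [matFun, dif_pos hA, matFun, dif_pos hB, eigenOverlap]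
    generalize (hA.eigenvectorUnitary : Matrix (Fin n) (Fin n) ℂ) = U at *
    generalize (hB.eigenvectorUnitary : Matrix (Fin n) (Fin n) ℂ) = V at *
    rw [mul_sub, sub_mul]
    congr 1
    · simp only [← mul_assoc, hU, one_mul]
    · simp only [mul_assoc, hV, mul_one]
  rw [key]
  ext i j
  simp only [Matrix.sub_apply, Matrix.diagonal_mul, Matrix.mul_diagonal, Matrix.of_apply]
  ring

theorem eigenOverlap_swap {n : ℕ} {A B : Matrix (Fin n) (Fin n) ℂ}
    (hA : A.IsHermitian) (hB : B.IsHermitian) (i j : Fin n) :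
    eigenOverlap hB hA j i = star (eigenOverlap hA hB i j) := by
  rw [← Matrix.star_apply, eigenOverlap, eigenOverlap, star_mul, star_star]

/-- Spectral expansion of the trace pairing `tr[(f(A) - f(B))(B - A)]`. -/
theorem trace_matFun_sub_mul_sub {n : ℕ} (f : ℝ → ℝ) {A B : Matrix (Fin n) (Fin n) ℂ}
    (hA : A.IsHermitian) (hB : B.IsHermitian) :
    ((matFun f A - matFun f B) * (B - A)).trace =
      ((∑ i, ∑ j, (f (hA.eigenvalues i) - f (hB.eigenvalues j)) *
        (hB.eigenvalues j - hA.eigenvalues i) *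
          Complex.normSq (eigenOverlap hA hB i j) : ℝ) : ℂ) := by
  have h1 := star_mul_matFun_sub_mul f f hA hB
  have h2 := star_mul_matFun_sub_mul (fun x => x) (fun x => x) hB hA
  rw [matFun_id hA, matFun_id hB] at h2
  have hU := Unitary.coe_mul_star_self hA.eigenvectorUnitary
  have hV := Unitary.coe_mul_star_self hB.eigenvectorUnitary
  rw [Unitary.coe_star] at hU hV
  have h3 : ((matFun f A - matFun f B) * (B - A)).trace =
      ((star (hA.eigenvectorUnitary : Matrix (Fin n) (Fin n) ℂ) * (matFun f A - matFun f B) *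
        (hB.eigenvectorUnitary : Matrix (Fin n) (Fin n) ℂ)) *
      (star (hB.eigenvectorUnitary : Matrix (Fin n) (Fin n) ℂ) * (B - A) *
        (hA.eigenvectorUnitary : Matrix (Fin n) (Fin n) ℂ))).trace := by
    generalize (hA.eigenvectorUnitary : Matrix (Fin n) (Fin n) ℂ) = U at *
    generalize (hB.eigenvectorUnitary : Matrix (Fin n) (Fin n) ℂ) = V at *
    have h4 : (star U * (matFun f A - matFun f B) * V) * (star V * (B - A) * U) =
        star U * ((matFun f A - matFun f B) * (V * star V) * (B - A) * U) := by
      simp only [mul_assoc]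
    rw [h4, hV, mul_one, Matrix.trace_mul_comm (star U), mul_assoc _ U, hU, mul_one]
  rw [h3, h1, h2, Matrix.trace]
  push_cast
  refine Finset.sum_congr rfl fun i _ => ?_
  rw [Matrix.diag_apply, Matrix.mul_apply]
  refine Finset.sum_congr rfl fun j _ => ?_
  rw [Matrix.of_apply, Matrix.of_apply, eigenOverlap_swap hA hB, Complex.normSq_eq_conj_mul_self,
    starRingEnd_apply]
  ring

/-- Two Hermitian matrices agree if eigenvectors for distinct eigenvalues are orthogonal. -/
theorem eq_of_eigenOverlap {n : ℕ} {A B : Matrix (Fin n) (Fin n) ℂ}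
    (hA : A.IsHermitian) (hB : B.IsHermitian)
    (h : ∀ i j, hA.eigenvalues i = hB.eigenvalues j ∨ eigenOverlap hA hB i j = 0) : A = B := by
  have h1 := star_mul_matFun_sub_mul (fun x => x) (fun x => x) hA hB
  rw [matFun_id hA, matFun_id hB] at h1
  have h2 : (Matrix.of fun i j => ((hA.eigenvalues i : ℂ) - hB.eigenvalues j) *
      eigenOverlap hA hB i j) = 0 := by
    ext i j
    rcases h i j with h | h <;> simp [h]
  rw [h2] at h1
  have hU := Unitary.coe_mul_star_self hA.eigenvectorUnitary
  have hV := Unitary.coe_mul_star_self hB.eigenvectorUnitary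
  rw [Unitary.coe_star] at hU hV
  generalize (hA.eigenvectorUnitary : Matrix (Fin n) (Fin n) ℂ) = U at *
  generalize (hB.eigenvectorUnitary : Matrix (Fin n) (Fin n) ℂ) = V at *
  have h3 : U * (star U * (A - B) * V) * star V = (U * star U) * (A - B) * (V * star V) := by
    simp only [mul_assoc]
  rw [h1, hU, hV, mul_zero, zero_mul, one_mul, mul_one] at h3
  exact sub_eq_zero.mp h3.symm

theorem strictAntiOn_log_one_sub_sub_log :
    StrictAntiOn (fun x : ℝ => Real.log (1 - x) - Real.log x) (Set.Ioo 0 1) := by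
  intro x hx y hy hxy
  have h1 := Real.log_lt_log hx.1 hxy
  have h2 := Real.log_lt_log (by linarith [hy.2] : 0 < 1 - y) (by linarith : 1 - y < 1 - x)
  dsimp only
  linarith

theorem StrictAntiOn.sub_mul_sub_pos {f : ℝ → ℝ} {s : Set ℝ} (hf : StrictAntiOn f s) {x y : ℝ}
    (hx : x ∈ s) (hy : y ∈ s) (hxy : x ≠ y) : 0 < (f x - f y) * (y - x) := by
  rcases hxy.lt_or_gt with h | h
  · exact mul_pos (sub_pos.mpr (hf hx hy h)) (sub_pos.mpr h)
  · exact mul_pos_of_neg_of_neg (sub_neg.mpr (hf hy hx h)) (sub_neg.mpr h)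

/-- Strict monotonicity of the trace pairing for a strictly decreasing function. -/
theorem exists_trace_matFun_sub_mul_sub_eq {n : ℕ} {f : ℝ → ℝ} {s : Set ℝ}
    (hf : StrictAntiOn f s) {A B : Matrix (Fin n) (Fin n) ℂ}
    (hA : A.IsHermitian) (hB : B.IsHermitian)
    (hAs : ∀ i, hA.eigenvalues i ∈ s) (hBs : ∀ i, hB.eigenvalues i ∈ s) :
    ∃ r : ℝ, ((matFun f A - matFun f B) * (B - A)).trace = (r : ℂ) ∧ 0 ≤ r ∧
      (r = 0 ↔ A = B) := by
  have hnn : ∀ i j, 0 ≤ (f (hA.eigenvalues i) - f (hB.eigenvalues j)) *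
      (hB.eigenvalues j - hA.eigenvalues i) * Complex.normSq (eigenOverlap hA hB i j) := by
    intro i j
    refine mul_nonneg ?_ (Complex.normSq_nonneg _)
    by_cases h : hA.eigenvalues i = hB.eigenvalues j
    · simp [h]
    · exact (hf.sub_mul_sub_pos (hAs i) (hBs j) h).le
  refine ⟨_, trace_matFun_sub_mul_sub f hA hB,
    Finset.sum_nonneg fun i _ => Finset.sum_nonneg fun j _ => hnn i j, fun h0 => ?_, fun h => ?_⟩
  · refine eq_of_eigenOverlap hA hB fun i j => ?_
    rw [Finset.sum_eq_zero_iff_of_nonneg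
      fun i _ => Finset.sum_nonneg fun j _ => hnn i j] at h0
    have h1 := h0 i (Finset.mem_univ i)
    rw [Finset.sum_eq_zero_iff_of_nonneg fun j _ => hnn i j] at h1
    rcases mul_eq_zero.mp (h1 j (Finset.mem_univ j)) with h2 | h2
    · by_contra! hne
      exact (hf.sub_mul_sub_pos (hAs i) (hBs j) hne.1).ne' h2
    · exact Or.inr (Complex.normSq_eq_zero.mp h2)
  · have ht := trace_matFun_sub_mul_sub f hA hB
    rw [← Complex.ofReal_eq_zero, ← ht, h, sub_self, sub_self, zero_mul, Matrix.trace_zero]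

/-- H-theorem for the matrix-valued BGK collision operator: the entropy production
`σ = (1/τ) ∫ tr[(h'(W(p)) - h'(W_eq(p)))(W_eq(p) - W(p))] dp` is nonnegative and
vanishes iff `W = W_eq` almost everywhere. -/
theorem bgk_H_theorem
    (d : ℕ) (hd : 1 ≤ d) (τ : ℝ) (hτ : 0 < τ)
    (W Weq : EuclideanSpace ℝ (Fin d) → Matrix (Fin 2) (Fin 2) ℂ)
    (hWmeas : ∀ i j, Measurable fun p => W p i j)
    (hWeqmeas : ∀ i j, Measurable fun p => Weq p i j)
    (hWherm : ∀ p, (W p).IsHermitian)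
    (hWeqherm : ∀ p, (Weq p).IsHermitian)
    (hWev : ∀ p i, (hWherm p).eigenvalues i ∈ Set.Ioo (0:ℝ) 1)
    (hWeqev : ∀ p i, (hWeqherm p).eigenvalues i ∈ Set.Ioo (0:ℝ) 1)
    (h' : ℝ → ℝ) (hh' : ∀ x : ℝ, h' x = Real.log (1 - x) - Real.log x)
    (hint : Integrable fun p =>
      ((matFun h' (W p) - matFun h' (Weq p)) * (Weq p - W p)).trace)
    (σ : ℂ)
    (hσ : σ = (1 / τ : ℝ) *
      ∫ p, ((matFun h' (W p) - matFun h' (Weq p)) * (Weq p - W p)).trace) :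
    0 ≤ σ ∧ (σ = 0 ↔ ∀ᵐ p, W p = Weq p) := by
  have hanti : StrictAntiOn h' (Set.Ioo 0 1) := by
    rw [funext hh']
    exact strictAntiOn_log_one_sub_sub_log
  choose g hg hg0 hgz using fun p => exists_trace_matFun_sub_mul_sub_eq hanti
    (hWherm p) (hWeqherm p) (hWev p) (hWeqev p)
  simp only [hg] at hint hσ
  have hgint : Integrable g := by simpa using hint.re
  rw [integral_complex_ofReal, ← Complex.ofReal_mul] at hσ
  have hτ' : 0 < 1 / τ := by positivity
  subst hσ
  refine ⟨?_, ?_⟩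
  · exact Complex.zero_le_real.mpr (mul_nonneg hτ'.le (integral_nonneg hg0))
  · rw [Complex.ofReal_eq_zero, mul_eq_zero, or_iff_right hτ'.ne',
      integral_eq_zero_iff_of_nonneg hg0 hgint]
    exact Filter.eventually_congr (Filter.Eventually.of_forall hgz)
end

section
/- (Moment exactness of the 3D polynomial equilibrium ansatz.) Fix β₀ > 0, ε ∈ ℝ, u ∈ ℝ³, and a Hermitian matrix ρ ∈ ℂ^{2×2}. Let n₀ = (2π/β₀)^{3/2} (1 − 2^{−1/2}) ζ(3/2), α_fac = 4 ζ(3/2) / (5 (9 − 5√2) ζ(3/2) ζ(7/2) − 3 (9 − 4√2) ζ(5/2)²), α₁ = α_fac ((5/4)(9 − 5√2) ζ(7/2) − (5 − 3√2) ζ(5/2) β₀ ε), α₂ = α_fac ((6 − 4√2) ζ(3/2) (2/3) β₀ ε − (5 − 3√2) ζ(5/2)), α₃ = 2 ζ(3/2) / ((3 + √2) ζ(5/2)), α₄ = α_fac (3 − 2√2) ζ(3/2), α₅ = −α_fac (5 − 3√2) ζ(5/2), and define W_eq(p) = (1/n₀)(exp(β₀ |p|²/2) + 1)^{−1} ρ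 (α₁ + α₂ β₀ |p|²/2 + α₃ β₀ (p·u) + α₄ (β₀ p·u)² + α₅ β₀ |u|²/2) for p ∈ ℝ³. Then ∫_{ℝ³} W_eq(p) dp = ρ, ∫_{ℝ³} p tr[W_eq(p)] dp = tr[ρ] u, and ∫_{ℝ³} (|p|²/2) tr[W_eq(p)] dp = tr[ρ] (ε + |u|²/2). -/
open MeasureTheory Matrix
open scoped RealInnerProductSpace

theorem hasSum_alternating_of_hasSum_rpow {s z : ℝ}
    (h : HasSum (fun n : ℕ ↦ 1 / ((n : ℝ) + 1) ^ s) z) :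
    HasSum (fun n : ℕ ↦ (-1) ^ n / ((n : ℝ) + 1) ^ s) ((1 - 2 ^ (1 - s)) * z) := by
  have hodd : HasSum (fun n : ℕ ↦ 1 / (((2 * n + 1 : ℕ) : ℝ) + 1) ^ s) (2 ^ (-s) * z) := by
    refine (h.mul_left (2 ^ (-s))).congr_fun fun n ↦ ?_
    have : ((2 * n + 1 : ℕ) : ℝ) + 1 = 2 * ((n : ℝ) + 1) := by push_cast; ring
    rw [this, Real.mul_rpow (by norm_num) (by positivity), Real.rpow_neg (by norm_num)]
    field_simp
  have hdiff : HasSum (fun n : ℕ ↦ (1 - (-1) ^ n) / ((n : ℝ) + 1) ^ s)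
      (0 + 2 * (2 ^ (-s) * z)) := by
    refine HasSum.even_add_odd ?_ ?_
    · simp
    · refine (hodd.mul_left 2).congr_fun fun n ↦ ?_
      rw [pow_succ, pow_mul]
      norm_num
      ring
  have hval : (1 - 2 ^ (1 - s)) * z = z - (0 + 2 * (2 ^ (-s) * z)) := by
    rw [Real.rpow_sub (by norm_num), Real.rpow_one, Real.rpow_neg (by norm_num)]
    ring
  rw [hval]
  exact (h.sub hdiff).congr_fun fun n ↦ by ring

theorem hasSum_one_div_rpow_of_eq_riemannZeta {s z : ℝ} (hs : 1 < s)
    (hz : (z : ℂ) = riemannZeta s) :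
    HasSum (fun n : ℕ ↦ 1 / ((n : ℝ) + 1) ^ s) z := by
  have hsum : Summable (fun n : ℕ ↦ 1 / ((n : ℝ) + 1) ^ s) := by
    simpa using (summable_nat_add_iff 1).2 (Real.summable_one_div_nat_rpow.2 hs)
  have : z = ∑' n : ℕ, 1 / ((n : ℝ) + 1) ^ s := by
    have h := zeta_eq_tsum_one_div_nat_add_one_cpow (s := (s : ℂ)) (by simpa using hs)
    rw [← hz] at h
    apply Complex.ofReal_injective
    rw [h, Complex.ofReal_tsum]
    refine tsum_congr fun n ↦ ?_
    rw [Complex.ofReal_div, Complex.ofReal_cpow (by positivity)]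
    simp
  rw [this]
  exact hsum.hasSum

theorem pos_of_eq_riemannZeta {s z : ℝ} (hs : 1 < s) (hz : (z : ℂ) = riemannZeta s) : 0 < z := by
  have h := le_hasSum (hasSum_one_div_rpow_of_eq_riemannZeta hs hz) 0 fun n _ ↦ by positivity
  norm_num at h
  linarith

theorem hasSum_inv_exp_add_one {t : ℝ} (ht : 0 < t) :
    HasSum (fun n : ℕ ↦ (-1) ^ n * Real.exp (-((n : ℝ) + 1) * t)) (Real.exp t + 1)⁻¹ := by
  have h1 : |-Real.exp (-t)| < 1 := by
    rw [abs_neg, abs_of_pos (Real.exp_pos _)]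
    simpa using ht
  have hval : (Real.exp t + 1)⁻¹ = Real.exp (-t) * (1 - -Real.exp (-t))⁻¹ := by
    rw [Real.exp_neg]
    rw [sub_neg_eq_add, ← _root_.mul_inv_rev, add_mul, inv_mul_cancel₀ (Real.exp_ne_zero t), one_mul]
  rw [hval]
  refine ((hasSum_geometric_of_abs_lt_one h1).mul_left (Real.exp (-t))).congr_fun fun n ↦ ?_
  rw [neg_pow (Real.exp (-t)), ← Real.exp_nat_mul, mul_left_comm, ← Real.exp_add]
  ring_nf

/-- The Fermi-Dirac integral in terms of the Riemann zeta function. -/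
theorem integral_rpow_mul_inv_exp_add_one {s z : ℝ} (hs : 1 < s)
    (hz : (z : ℂ) = riemannZeta s) :
    ∫ x in Set.Ioi (0 : ℝ), x ^ (s - 1) * (Real.exp x + 1)⁻¹
      = Real.Gamma s * ((1 - 2 ^ (1 - s)) * z) := by
  have hζ := hasSum_one_div_rpow_of_eq_riemannZeta hs hz
  have hη := hasSum_alternating_of_hasSum_rpow hζ
  have hM := hasSum_mellin (a := fun n : ℕ ↦ (-1) ^ n) (p := fun n : ℕ ↦ (n : ℝ) + 1)
    (F := fun t ↦ ((Real.exp t + 1)⁻¹ : ℝ)) (s := s) (fun n ↦ Or.inr (by positivity))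
    (by simp; linarith)
    (fun t ht ↦ by
      have := hasSum_inv_exp_add_one ht
      exact_mod_cast Complex.hasSum_ofReal.2 this)
    (by simpa using hζ.summable)
  have hη' := Complex.hasSum_ofReal.2 (hη.mul_left (Real.Gamma s))
  have := hM.unique (hη'.congr_fun fun n ↦ by
    rw [Complex.ofReal_mul, Complex.ofReal_div, Complex.ofReal_cpow (by positivity),
      Complex.Gamma_ofReal]
    push_cast
    ring)
  rw [← Complex.ofReal_inj, ← this, mellin, ← integral_complex_ofReal]
  refine setIntegral_congr_fun measurableSet_Ioi fun x hx ↦ ?_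
  simp only [smul_eq_mul]
  rw [Complex.ofReal_mul, Complex.ofReal_cpow (le_of_lt hx)]
  push_cast
  ring

theorem volume_real_ball_fin_three :
    (volume : Measure (EuclideanSpace ℝ (Fin 3))).real (Metric.ball 0 1) = 4 * Real.pi / 3 := by
  rw [Measure.real, EuclideanSpace.volume_ball_fin_three]
  simp
  rw [ENNReal.toReal_ofReal (by positivity)]
  ring

theorem integral_norm_pow_mul_fermi {β z : ℝ} (hβ : 0 < β) (k : ℕ)
    (hz : (z : ℂ) = riemannZeta ((k + 3 / 2 : ℝ) : ℂ)) :
    ∫ p : EuclideanSpace ℝ (Fin 3), ‖p‖ ^ (2 * k) * (Real.exp (β * ‖p‖ ^ 2 / 2) + 1)⁻¹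
      = 2 * Real.pi * (2 / β) ^ (k + 3 / 2 : ℝ) *
        (Real.Gamma (k + 3 / 2) * ((1 - 2 ^ (1 - (k + 3 / 2 : ℝ))) * z)) := by
  rw [integral_fun_norm_addHaar volume
    (fun r : ℝ ↦ r ^ (2 * k) * (Real.exp (β * r ^ 2 / 2) + 1)⁻¹), volume_real_ball_fin_three,
    ← integral_rpow_mul_inv_exp_add_one (by have : (0 : ℝ) ≤ k := k.cast_nonneg
                                            linarith) hz]
  set g : ℝ → ℝ := fun x ↦ x ^ ((k + 3 / 2 : ℝ) - 1) * (Real.exp x + 1)⁻¹ with hg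
  have h1 := integral_comp_rpow_Ioi_of_pos (g := fun y ↦ g (β / 2 * y)) (two_pos (α := ℝ))
  rw [integral_comp_mul_left_Ioi g 0 (by positivity : 0 < β / 2), mul_zero] at h1
  have h2 : ∀ x ∈ Set.Ioi (0 : ℝ), (2 * x ^ (2 - 1 : ℝ)) • (fun y ↦ g (β / 2 * y)) (x ^ (2 : ℝ)) =
      2 * (β / 2) ^ (k + 1 / 2 : ℝ) *
        (x ^ 2 * (x ^ (2 * k) * (Real.exp (β * x ^ 2 / 2) + 1)⁻¹)) := by
    intro x hx
    have hx' : (0 : ℝ) < x := hx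
    have e1 : (x ^ 2) ^ (k + 1 / 2 : ℝ) = x ^ (2 * k) * x := by
      rw [Real.rpow_add (by positivity), Real.rpow_natCast, ← pow_mul, ← Real.sqrt_eq_rpow,
        Real.sqrt_sq hx'.le]
    simp only [hg, smul_eq_mul, Real.rpow_two]
    rw [show (k + 3 / 2 : ℝ) - 1 = k + 1 / 2 by ring, Real.mul_rpow (by positivity) (by positivity),
      e1, show β / 2 * x ^ 2 = β * x ^ 2 / 2 by ring]
    norm_num
    ring
  rw [setIntegral_congr_fun measurableSet_Ioi h2, integral_const_mul] at h1
  simp only [finrank_euclideanSpace, Fintype.card_fin, smul_eq_mul, nsmul_eq_mul] at h1 ⊢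
  have e2 : (2 / β) ^ (k + 3 / 2 : ℝ) * (β / 2) ^ (k + 1 / 2 : ℝ) = (β / 2)⁻¹ := by
    rw [show (2 / β : ℝ) = (β / 2)⁻¹ by simp, Real.inv_rpow (by positivity),
      ← Real.rpow_neg (by positivity), ← Real.rpow_add (by positivity), ← Real.rpow_neg_one]
    ring_nf
  have hb : (β / 2)⁻¹ ≠ 0 := by positivity
  refine mul_left_cancel₀ hb ?_
  linear_combination 2 * Real.pi * (2 / β) ^ (k + 3 / 2 : ℝ) * h1 - 4 * Real.pi *
    (∫ x in Set.Ioi (0 : ℝ), x ^ 2 * (x ^ (2 * k) * (Real.exp (β * x ^ 2 / 2) + 1)⁻¹)) * e2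

theorem integrable_norm_pow_mul_fermi {β : ℝ} (hβ : 0 < β) (k : ℕ) :
    Integrable fun p : EuclideanSpace ℝ (Fin 3) ↦
      ‖p‖ ^ k * (Real.exp (β * ‖p‖ ^ 2 / 2) + 1)⁻¹ := by
  rw [integrable_fun_norm_addHaar volume
    (f := fun r : ℝ ↦ r ^ k * (Real.exp (β * r ^ 2 / 2) + 1)⁻¹)]
  have h := integrableOn_rpow_mul_exp_neg_mul_sq (half_pos hβ) (s := (k + 2 : ℕ))
    (by have : (0 : ℝ) ≤ (k + 2 : ℕ) := Nat.cast_nonneg _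
        linarith)
  refine Integrable.mono' h (by fun_prop) ?_
  filter_upwards [ae_restrict_mem measurableSet_Ioi] with x hx
  have hx' : (0 : ℝ) < x := hx
  have : (Real.exp (β * x ^ 2 / 2) + 1)⁻¹ ≤ Real.exp (-(β / 2) * x ^ 2) := by
    rw [show -(β / 2) * x ^ 2 = -(β * x ^ 2 / 2) by ring, Real.exp_neg]
    gcongr
    linarith
  rw [Real.norm_of_nonneg (by simp only [smul_eq_mul]; positivity), Real.rpow_natCast]
  simp only [finrank_euclideanSpace, Fintype.card_fin, smul_eq_mul]
  rw [← mul_assoc, ← pow_add, add_comm]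
  gcongr

section Radial

variable {ι : Type*} [Fintype ι]

/-- Integrals of odd functions against an even weight. -/
theorem integral_eq_zero_of_odd {f : EuclideanSpace ℝ ι → ℝ} (hf : ∀ p, f (-p) = -f p) :
    ∫ p, f p = 0 := by
  have h := integral_neg_eq_self f volume
  simp only [hf, integral_neg] at h
  linarith

theorem integral_coord_mul_coord_radial_of_ne [DecidableEq ι] (f : ℝ → ℝ) {i j : ι} (hij : i ≠ j) :
    ∫ p : EuclideanSpace ℝ ι, p i * p j * f ‖p‖ = 0 := by
  let e : EuclideanSpace ℝ ι ≃ₗᵢ[ℝ] EuclideanSpace ℝ ι :=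
    LinearIsometryEquiv.piLpCongrRight 2 fun k ↦
      if k = i then LinearIsometryEquiv.neg ℝ else LinearIsometryEquiv.refl ℝ ℝ
  have h := e.measurePreserving.integral_comp e.toHomeomorph.measurableEmbedding
    (fun p ↦ p i * p j * f ‖p‖)
  have hi : ∀ p, e p i = -p i := fun p ↦ by simp [e]
  have hj : ∀ p, e p j = p j := fun p ↦ by simp [e, hij.symm]
  simp only [hi, hj, LinearIsometryEquiv.norm_map, neg_mul, integral_neg] at h
  linarith

theorem integral_coord_sq_radial_eq [DecidableEq ι] (f : ℝ → ℝ) (i j : ι) :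
    ∫ p : EuclideanSpace ℝ ι, p i * p i * f ‖p‖ = ∫ p : EuclideanSpace ℝ ι, p j * p j * f ‖p‖ := by
  let e : EuclideanSpace ℝ ι ≃ₗᵢ[ℝ] EuclideanSpace ℝ ι :=
    LinearIsometryEquiv.piLpCongrLeft 2 ℝ ℝ (Equiv.swap i j)
  have h := e.measurePreserving.integral_comp e.toHomeomorph.measurableEmbedding
    (fun p ↦ p i * p i * f ‖p‖)
  have hi : ∀ p, e p i = p j := fun p ↦ by
    simp [e, LinearIsometryEquiv.piLpCongrLeft_apply, Equiv.piCongrLeft'_apply]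
  simp only [hi, LinearIsometryEquiv.norm_map] at h
  exact h.symm

theorem integrable_inner_pow_mul_inner_pow_radial {f : ℝ → ℝ} (hfm : Measurable f) (m n : ℕ)
    (hf : Integrable fun p : EuclideanSpace ℝ ι ↦ ‖p‖ ^ (m + n) * f ‖p‖)
    (u v : EuclideanSpace ℝ ι) :
    Integrable fun p : EuclideanSpace ℝ ι ↦ ⟪p, u⟫ ^ m * ⟪p, v⟫ ^ n * f ‖p‖ := by
  refine Integrable.mono' (hf.norm.const_mul (‖u‖ ^ m * ‖v‖ ^ n)) (by fun_prop)
    (.of_forall fun p ↦ ?_)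
  rw [norm_mul, norm_mul, norm_mul, norm_pow, norm_pow, norm_pow, norm_norm]
  calc ‖⟪p, u⟫‖ ^ m * ‖⟪p, v⟫‖ ^ n * ‖f ‖p‖‖
      ≤ (‖p‖ * ‖u‖) ^ m * (‖p‖ * ‖v‖) ^ n * ‖f ‖p‖‖ := by
        gcongr <;> exact norm_inner_le_norm _ _
    _ = _ := by ring

theorem integral_inner_mul_inner_radial [DecidableEq ι] [Nonempty ι] {f : ℝ → ℝ}
    (hfm : Measurable f) (hf : Integrable fun p : EuclideanSpace ℝ ι ↦ ‖p‖ ^ 2 * f ‖p‖) (u v : EuclideanSpace ℝ ι) :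
    ∫ p : EuclideanSpace ℝ ι, ⟪p, u⟫ * ⟪p, v⟫ * f ‖p‖ =
      ⟪u, v⟫ / Fintype.card ι * ∫ p : EuclideanSpace ℝ ι, ‖p‖ ^ 2 * f ‖p‖ := by
  have hint : ∀ i j : ι, Integrable fun p : EuclideanSpace ℝ ι ↦ p i * p j * f ‖p‖ := fun i j ↦ by
    simpa [EuclideanSpace.inner_single_right] using integrable_inner_pow_mul_inner_pow_radial hfm 1 1 hf
      (EuclideanSpace.single i 1) (EuclideanSpace.single j 1)
  have hdiag : ∀ i : ι, ∫ p : EuclideanSpace ℝ ι, p i * p i * f ‖p‖ =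
      (∫ p : EuclideanSpace ℝ ι, ‖p‖ ^ 2 * f ‖p‖) / Fintype.card ι := fun i ↦ by
    have : ∫ p : EuclideanSpace ℝ ι, ‖p‖ ^ 2 * f ‖p‖ =
        ∑ j, ∫ p : EuclideanSpace ℝ ι, p j * p j * f ‖p‖ := by
      rw [← integral_finsetSum _ fun j _ ↦ hint j j]
      simp_rw [EuclideanSpace.real_norm_sq_eq, Finset.sum_mul, pow_two]
    rw [this, Finset.sum_congr rfl fun j _ ↦ integral_coord_sq_radial_eq f j i]
    simp
  have hexp : ∀ p : EuclideanSpace ℝ ι, ⟪p, u⟫ * ⟪p, v⟫ * f ‖p‖ =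
      ∑ i, ∑ j, u i * v j * (p i * p j * f ‖p‖) := fun p ↦ by
    simp only [PiLp.inner_apply, RCLike.inner_apply, conj_trivial]
    rw [Finset.sum_mul_sum, Finset.sum_mul]
    simp only [Finset.sum_mul]
    exact Finset.sum_congr rfl fun i _ ↦ Finset.sum_congr rfl fun j _ ↦ by ring
  simp_rw [hexp]
  rw [integral_finsetSum _ fun i _ ↦ integrable_finsetSum _ fun j _ ↦ (hint i j).const_mul _]
  simp_rw [integral_finsetSum _ fun j _ ↦ (hint _ j).const_mul _, integral_const_mul]
  rw [PiLp.inner_apply, div_mul_eq_mul_div, Finset.sum_mul, Finset.sum_div]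
  refine Finset.sum_congr rfl fun i _ ↦ ?_
  rw [Finset.sum_eq_single i (fun j _ hj ↦ by
    rw [integral_coord_mul_coord_radial_of_ne f hj.symm, mul_zero]) (by simp), hdiag]
  simp
  ring

/-- Zeroth moment of a radial weight times a quadratic polynomial. -/
theorem integral_radial_mul_quadratic [DecidableEq ι] [Nonempty ι] {f : ℝ → ℝ}
    (hfm : Measurable f) (hf : ∀ k ≤ 2, Integrable fun p : EuclideanSpace ℝ ι ↦ ‖p‖ ^ k * f ‖p‖)
    (u : EuclideanSpace ℝ ι) (a b d e : ℝ) :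
    ∫ p : EuclideanSpace ℝ ι, f ‖p‖ * (a + b * ‖p‖ ^ 2 + d * ⟪p, u⟫ + e * ⟪p, u⟫ ^ 2) =
      a * (∫ p : EuclideanSpace ℝ ι, f ‖p‖) +
        (b + e * (‖u‖ ^ 2 / Fintype.card ι)) * ∫ p : EuclideanSpace ℝ ι, ‖p‖ ^ 2 * f ‖p‖ := by
  have h0 : Integrable fun p : EuclideanSpace ℝ ι ↦ f ‖p‖ := by simpa using hf 0 (by norm_num)
  have h2 := hf 2 le_rfl
  have hu : Integrable fun p : EuclideanSpace ℝ ι ↦ ⟪p, u⟫ * f ‖p‖ := by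
    simpa using integrable_inner_pow_mul_inner_pow_radial hfm 1 0 (hf 1 (by norm_num)) u 0
  have huu : Integrable fun p : EuclideanSpace ℝ ι ↦ ⟪p, u⟫ * ⟪p, u⟫ * f ‖p‖ := by
    simpa using integrable_inner_pow_mul_inner_pow_radial hfm 1 1 h2 u u
  have hodd : ∫ p : EuclideanSpace ℝ ι, ⟪p, u⟫ * f ‖p‖ = 0 :=
    integral_eq_zero_of_odd fun p ↦ by simp
  have hsplit : ∀ p : EuclideanSpace ℝ ι,
      f ‖p‖ * (a + b * ‖p‖ ^ 2 + d * ⟪p, u⟫ + e * ⟪p, u⟫ ^ 2) =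
      a * f ‖p‖ + b * (‖p‖ ^ 2 * f ‖p‖) + d * (⟪p, u⟫ * f ‖p‖) +
        e * (⟪p, u⟫ * ⟪p, u⟫ * f ‖p‖) := fun p ↦ by ring
  simp_rw [hsplit]
  rw [integral_add (((h0.const_mul a).fun_add (h2.const_mul b)).fun_add (hu.const_mul d))
      (huu.const_mul e), integral_add ((h0.const_mul a).fun_add (h2.const_mul b)) (hu.const_mul d),
    integral_add (h0.const_mul a) (h2.const_mul b)]
  simp only [integral_const_mul]
  rw [hodd, integral_inner_mul_inner_radial hfm h2, real_inner_self_eq_norm_sq]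
  ring

/-- First moment of a radial weight times a quadratic polynomial. -/
theorem integral_inner_mul_radial_mul_quadratic [DecidableEq ι] [Nonempty ι] {f : ℝ → ℝ}
    (hfm : Measurable f) (hf : ∀ k ≤ 3, Integrable fun p : EuclideanSpace ℝ ι ↦ ‖p‖ ^ k * f ‖p‖)
    (u v : EuclideanSpace ℝ ι) (a b d e : ℝ) :
    ∫ p : EuclideanSpace ℝ ι,
      ⟪p, v⟫ * (f ‖p‖ * (a + b * ‖p‖ ^ 2 + d * ⟪p, u⟫ + e * ⟪p, u⟫ ^ 2)) =
      d * (⟪u, v⟫ / Fintype.card ι) * ∫ p : EuclideanSpace ℝ ι, ‖p‖ ^ 2 * f ‖p‖ := by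
  have h2 := hf 2 (by norm_num)
  have hv : Integrable fun p : EuclideanSpace ℝ ι ↦ ⟪p, v⟫ * f ‖p‖ := by
    simpa using integrable_inner_pow_mul_inner_pow_radial hfm 1 0 (hf 1 (by norm_num)) v 0
  have hnv : Integrable fun p : EuclideanSpace ℝ ι ↦ ⟪p, v⟫ * (‖p‖ ^ 2 * f ‖p‖) := by
    simpa using integrable_inner_pow_mul_inner_pow_radial (f := fun r ↦ r ^ 2 * f r)
      (by fun_prop) 1 0 ((hf 3 le_rfl).congr (.of_forall fun p ↦ by simp; ring)) v 0
  have huv : Integrable fun p : EuclideanSpace ℝ ι ↦ ⟪p, u⟫ * ⟪p, v⟫ * f ‖p‖ := by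
    simpa using integrable_inner_pow_mul_inner_pow_radial hfm 1 1 h2 u v
  have huuv : Integrable fun p : EuclideanSpace ℝ ι ↦ ⟪p, u⟫ ^ 2 * ⟪p, v⟫ * f ‖p‖ := by
    simpa using integrable_inner_pow_mul_inner_pow_radial hfm 2 1 (hf 3 le_rfl) u v
  have hsplit : ∀ p : EuclideanSpace ℝ ι,
      ⟪p, v⟫ * (f ‖p‖ * (a + b * ‖p‖ ^ 2 + d * ⟪p, u⟫ + e * ⟪p, u⟫ ^ 2)) =
      (a * (⟪p, v⟫ * f ‖p‖) + b * (⟪p, v⟫ * (‖p‖ ^ 2 * f ‖p‖)) +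
        e * (⟪p, u⟫ ^ 2 * ⟪p, v⟫ * f ‖p‖)) + d * (⟪p, u⟫ * ⟪p, v⟫ * f ‖p‖) := fun p ↦ by ring
  simp_rw [hsplit]
  rw [integral_add (by fun_prop) (by fun_prop),
    integral_eq_zero_of_odd fun p ↦ by simp; ring, integral_const_mul,
    integral_inner_mul_inner_radial hfm h2]
  ring

/-- Second moment of a radial weight times a quadratic polynomial. -/
theorem integral_norm_sq_mul_radial_mul_quadratic [DecidableEq ι] [Nonempty ι] {f : ℝ → ℝ}
    (hfm : Measurable f) (hf : ∀ k ≤ 4, Integrable fun p : EuclideanSpace ℝ ι ↦ ‖p‖ ^ k * f ‖p‖)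
    (u : EuclideanSpace ℝ ι) (a b d e : ℝ) :
    ∫ p : EuclideanSpace ℝ ι,
      ‖p‖ ^ 2 * (f ‖p‖ * (a + b * ‖p‖ ^ 2 + d * ⟪p, u⟫ + e * ⟪p, u⟫ ^ 2)) =
      a * (∫ p : EuclideanSpace ℝ ι, ‖p‖ ^ 2 * f ‖p‖) +
        (b + e * (‖u‖ ^ 2 / Fintype.card ι)) * ∫ p : EuclideanSpace ℝ ι, ‖p‖ ^ 4 * f ‖p‖ := by
  have h := integral_radial_mul_quadratic (f := fun r ↦ r ^ 2 * f r) (by fun_prop)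
    (fun k hk ↦ (hf (k + 2) (by lia)).congr (.of_forall fun p ↦ by simp; ring)) u a b d e
  simp only [← mul_assoc, ← pow_add] at h ⊢
  exact h

end Radial

theorem zeroth_moment_identity {A s z3 z5 z7 x U : ℝ} (hs : s ^ 2 = 2)
    (hA : A * (5 * (9 - 5 * s) * z3 * z7 - 3 * (9 - 4 * s) * z5 ^ 2) = 4 * z3) :
    (A * (5 / 4 * (9 - 5 * s) * z7 - (5 - 3 * s) * z5 * x) - A * (5 - 3 * s) * z5 * U / 2) *
        ((1 - s / 2) * z3) +
      (A * ((6 - 4 * s) * z3 * (2 / 3 * x) - (5 - 3 * s) * z5) / 2 + A * (3 - 2 * s) * z3 * U / 3) *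
        (3 * (1 - s / 4) * z5) = (1 - s / 2) * z3 := by
  grind

theorem second_moment_identity {A s z3 z5 z7 x U : ℝ} (hs : s ^ 2 = 2)
    (hA : A * (5 * (9 - 5 * s) * z3 * z7 - 3 * (9 - 4 * s) * z5 ^ 2) = 4 * z3) :
    (A * (5 / 4 * (9 - 5 * s) * z7 - (5 - 3 * s) * z5 * x) - A * (5 - 3 * s) * z5 * U / 2) *
        (3 * (1 - s / 4) * z5) +
      (A * ((6 - 4 * s) * z3 * (2 / 3 * x) - (5 - 3 * s) * z5) / 2 + A * (3 - 2 * s) * z3 * U / 3) *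
        (15 * (1 - s / 8) * z7) = (2 * x + U) * ((1 - s / 2) * z3) := by
  grind

section FermiMoments

variable {β z : ℝ}

theorem two_pi_mul_rpow_mul_Gamma (hβ : 0 < β) :
    2 * Real.pi * ((2 / β) ^ (3 / 2 : ℝ) * Real.Gamma (3 / 2)) =
      (2 * Real.pi / β) ^ (3 / 2 : ℝ) := by
  have hΓ : Real.Gamma (3 / 2) = √Real.pi / 2 := by
    rw [show (3 / 2 : ℝ) = 1 / 2 + 1 by norm_num, Real.Gamma_add_one (by norm_num),
      Real.Gamma_one_half_eq]
    ring
  have hπ : Real.pi ^ (3 / 2 : ℝ) = Real.pi * √Real.pi := by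
    rw [show (3 / 2 : ℝ) = 1 + 1 / 2 by norm_num, Real.rpow_add Real.pi_pos, Real.rpow_one,
      Real.sqrt_eq_rpow]
  rw [mul_div_right_comm, Real.mul_rpow (by positivity) Real.pi_pos.le, hΓ, hπ]
  ring

theorem two_rpow_neg_half : (2 : ℝ) ^ (-(1 / 2) : ℝ) = √2 / 2 := by
  rw [Real.rpow_neg (by norm_num), ← Real.sqrt_eq_rpow, inv_eq_one_div,
    ← Real.sqrt_div_self' (x := 2)]

theorem integral_fermi (hβ : 0 < β) (hz : (z : ℂ) = riemannZeta (3 / 2)) :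
    ∫ p : EuclideanSpace ℝ (Fin 3), (Real.exp (β * ‖p‖ ^ 2 / 2) + 1)⁻¹ =
      (2 * Real.pi / β) ^ (3 / 2 : ℝ) * ((1 - √2 / 2) * z) := by
  have h := integral_norm_pow_mul_fermi hβ 0 (z := z) (by rw [hz]; push_cast; norm_num)
  simp only [mul_zero, pow_zero, one_mul, Nat.cast_zero, zero_add] at h
  rw [h, ← two_pi_mul_rpow_mul_Gamma hβ, show (1 - 3 / 2 : ℝ) = -(1 / 2) by norm_num,
    two_rpow_neg_half]
  ring

theorem integral_norm_sq_mul_fermi (hβ : 0 < β) (hz : (z : ℂ) = riemannZeta (5 / 2)) :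
    ∫ p : EuclideanSpace ℝ (Fin 3), ‖p‖ ^ 2 * (Real.exp (β * ‖p‖ ^ 2 / 2) + 1)⁻¹ =
      (2 * Real.pi / β) ^ (3 / 2 : ℝ) / β * (3 * (1 - √2 / 4) * z) := by
  have h := integral_norm_pow_mul_fermi hβ 1 (z := z) (by rw [hz]; push_cast; norm_num)
  simp only [mul_one, Nat.cast_one] at h
  rw [h, ← two_pi_mul_rpow_mul_Gamma hβ, show (1 - (1 + 3 / 2) : ℝ) = -(1 / 2) - 1 by norm_num,
    Real.rpow_sub two_pos, two_rpow_neg_half, Real.rpow_one, add_comm (1 : ℝ),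
    Real.rpow_add_one (by positivity), Real.Gamma_add_one (by norm_num)]
  ring

theorem integral_norm_pow_four_mul_fermi (hβ : 0 < β) (hz : (z : ℂ) = riemannZeta (7 / 2)) :
    ∫ p : EuclideanSpace ℝ (Fin 3), ‖p‖ ^ 4 * (Real.exp (β * ‖p‖ ^ 2 / 2) + 1)⁻¹ =
      (2 * Real.pi / β) ^ (3 / 2 : ℝ) / β ^ 2 * (15 * (1 - √2 / 8) * z) := by
  have h := integral_norm_pow_mul_fermi hβ 2 (z := z) (by rw [hz]; push_cast; norm_num)
  simp only [Nat.reduceMul, Nat.cast_ofNat] at h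
  rw [h, ← two_pi_mul_rpow_mul_Gamma hβ, show (1 - (2 + 3 / 2) : ℝ) = -(1 / 2) - 2 by norm_num,
    Real.rpow_sub two_pos, two_rpow_neg_half, Real.rpow_two,
    show (2 + 3 / 2 : ℝ) = 3 / 2 + 1 + 1 by norm_num,
    Real.rpow_add_one (by positivity), Real.rpow_add_one (by positivity),
    Real.Gamma_add_one (by norm_num), Real.Gamma_add_one (by norm_num)]
  ring

theorem integral_sq_mul_fermi_pos (a b : ℝ) (hβ : 0 < β) (hab : a ≠ 0 ∨ b ≠ 0) :
    0 < a ^ 2 * (∫ p : EuclideanSpace ℝ (Fin 3), ‖p‖ ^ 4 * (Real.exp (β * ‖p‖ ^ 2 / 2) + 1)⁻¹) +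
      2 * a * b * (∫ p : EuclideanSpace ℝ (Fin 3),
        ‖p‖ ^ 2 * (Real.exp (β * ‖p‖ ^ 2 / 2) + 1)⁻¹) +
      b ^ 2 * ∫ p : EuclideanSpace ℝ (Fin 3), (Real.exp (β * ‖p‖ ^ 2 / 2) + 1)⁻¹ := by
  have h4 := integrable_norm_pow_mul_fermi hβ 4
  have h2 := integrable_norm_pow_mul_fermi hβ 2
  have h0 : Integrable fun p : EuclideanSpace ℝ (Fin 3) ↦ (Real.exp (β * ‖p‖ ^ 2 / 2) + 1)⁻¹ := by
    simpa using integrable_norm_pow_mul_fermi hβ 0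
  have hsplit : ∀ p : EuclideanSpace ℝ (Fin 3),
      (a * ‖p‖ ^ 2 + b) ^ 2 * (Real.exp (β * ‖p‖ ^ 2 / 2) + 1)⁻¹ =
      a ^ 2 * (‖p‖ ^ 4 * (Real.exp (β * ‖p‖ ^ 2 / 2) + 1)⁻¹) +
        2 * a * b * (‖p‖ ^ 2 * (Real.exp (β * ‖p‖ ^ 2 / 2) + 1)⁻¹) +
        b ^ 2 * (Real.exp (β * ‖p‖ ^ 2 / 2) + 1)⁻¹ := fun p ↦ by ring
  have h42 := (h4.const_mul (a ^ 2)).fun_add (h2.const_mul (2 * a * b))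
  have hint : Integrable fun p : EuclideanSpace ℝ (Fin 3) ↦
      (a * ‖p‖ ^ 2 + b) ^ 2 * (Real.exp (β * ‖p‖ ^ 2 / 2) + 1)⁻¹ := by
    simp_rw [hsplit]
    exact h42.fun_add (h0.const_mul (b ^ 2))
  rw [← integral_const_mul, ← integral_const_mul, ← integral_const_mul,
    ← integral_add (h4.const_mul (a ^ 2)) (h2.const_mul (2 * a * b)),
    ← integral_add h42 (h0.const_mul (b ^ 2))]
  simp_rw [← hsplit]
  obtain ⟨p, hp⟩ : ∃ p : EuclideanSpace ℝ (Fin 3), a * ‖p‖ ^ 2 + b ≠ 0 := by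
    by_contra! h
    have hb : b = 0 := by simpa using h 0
    have ha : a = 0 := by simpa [hb] using h (EuclideanSpace.single 0 1)
    exact hab.elim (· ha) (· hb)
  refine integral_pos_of_integrable_nonneg_nonzero (x := p) ?_ hint (fun p ↦ by positivity) ?_
  · have : ∀ p : EuclideanSpace ℝ (Fin 3), Real.exp (β * ‖p‖ ^ 2 / 2) + 1 ≠ 0 := fun p ↦ by
      positivity
    fun_prop (disch := assumption)
  · positivity

end FermiMoments

/-- Moment exactness of the 3D polynomial equilibrium ansatz: the polynomial
approximation of the Fermi-Dirac equilibrium reproduces the prescribed density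
matrix `ρ`, velocity `u` and internal energy `ε`. Here `z32, z52, z72` denote the
real numbers equal to `ζ(3/2), ζ(5/2), ζ(7/2)`. -/
theorem poly_equilibrium_moments_3d
    (β₀ ε : ℝ) (hβ₀ : 0 < β₀) (u : EuclideanSpace ℝ (Fin 3))
    (ρ : Matrix (Fin 2) (Fin 2) ℂ) (hρ : ρ.IsHermitian)
    (z32 z52 z72 : ℝ)
    (hz32 : (z32 : ℂ) = riemannZeta (3/2))
    (hz52 : (z52 : ℂ) = riemannZeta (5/2))
    (hz72 : (z72 : ℂ) = riemannZeta (7/2))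
    (n₀ αfac α₁ α₂ α₃ α₄ α₅ : ℝ)
    (hn₀ : n₀ = (2 * Real.pi / β₀) ^ ((3:ℝ)/2) * (1 - 2 ^ (-(1:ℝ)/2)) * z32)
    (hαfac : αfac = 4 * z32 /
      (5 * (9 - 5 * Real.sqrt 2) * z32 * z72 - 3 * (9 - 4 * Real.sqrt 2) * z52 ^ 2))
    (hα₁ : α₁ = αfac * ((5/4) * (9 - 5 * Real.sqrt 2) * z72
      - (5 - 3 * Real.sqrt 2) * z52 * (β₀ * ε)))
    (hα₂ : α₂ = αfac * ((6 - 4 * Real.sqrt 2) * z32 * ((2/3) * (β₀ * ε))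
      - (5 - 3 * Real.sqrt 2) * z52))
    (hα₃ : α₃ = 2 * z32 / ((3 + Real.sqrt 2) * z52))
    (hα₄ : α₄ = αfac * (3 - 2 * Real.sqrt 2) * z32)
    (hα₅ : α₅ = -(αfac * (5 - 3 * Real.sqrt 2) * z52))
    (Weq : EuclideanSpace ℝ (Fin 3) → Matrix (Fin 2) (Fin 2) ℂ)
    (hWeq : ∀ p, Weq p =
      ((((1 / n₀) * (Real.exp (β₀ * ‖p‖ ^ 2 / 2) + 1)⁻¹ *
        (α₁ + α₂ * (β₀ * (‖p‖ ^ 2 / 2)) + α₃ * (β₀ * ⟪p, u⟫) +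
          α₄ * (β₀ * ⟪p, u⟫) ^ 2 + α₅ * (β₀ * (‖u‖ ^ 2 / 2))) : ℝ) : ℂ)) • ρ) :
    (∀ i j, (∫ p, Weq p i j) = ρ i j) ∧
    (∀ k : Fin 3, (∫ p, (p k : ℂ) * (Weq p).trace) = ρ.trace * (u k : ℂ)) ∧
    (∫ p, ((‖p‖ ^ 2 / 2 : ℝ) : ℂ) * (Weq p).trace)
      = ρ.trace * ((ε + ‖u‖ ^ 2 / 2 : ℝ) : ℂ) := by
  have hs : √2 ^ 2 = (2 : ℝ) := Real.sq_sqrt (by norm_num)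
  have hs_pos : 0 < √2 := Real.sqrt_pos.2 two_pos
  have hs_lt : √2 < 2 := by nlinarith
  have hI0 := integral_fermi hβ₀ hz32
  have hI2 := integral_norm_sq_mul_fermi hβ₀ hz52
  have hI4 := integral_norm_pow_four_mul_fermi hβ₀ hz72
  set f : ℝ → ℝ := fun r ↦ (Real.exp (β₀ * r ^ 2 / 2) + 1)⁻¹ with hf
  set c : ℝ := (2 * Real.pi / β₀) ^ (3 / 2 : ℝ)
  have hc_pos : 0 < c := by positivity
  have hn₀' : n₀ = c * ((1 - √2 / 2) * z32) := by
    rw [hn₀, neg_div, two_rpow_neg_half, mul_assoc]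
  have hz32_pos : 0 < z32 :=
    pos_of_eq_riemannZeta (s := 3 / 2) (by norm_num) (by rw [hz32]; push_cast; rfl)
  have hz52_pos : 0 < z52 :=
    pos_of_eq_riemannZeta (s := 5 / 2) (by norm_num) (by rw [hz52]; push_cast; rfl)
  have hn₀_ne : n₀ ≠ 0 := by
    rw [hn₀']
    have : 0 < 1 - √2 / 2 := by linarith
    positivity
  have hden : 5 * (9 - 5 * √2) * z32 * z72 - 3 * (9 - 4 * √2) * z52 ^ 2 ≠ 0 := by
    intro hD
    have h := integral_sq_mul_fermi_pos (c * ((1 - √2 / 2) * z32))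
      (-(c / β₀ * (3 * (1 - √2 / 4) * z52))) hβ₀ (.inl (hn₀' ▸ hn₀_ne))
    rw [hI0, hI2, hI4] at h
    refine h.ne' ?_
    linear_combination 3 / 8 * (c * ((1 - √2 / 2) * z32)) * (c / β₀) ^ 2 * hD +
      3 / 16 * (c * ((1 - √2 / 2) * z32)) * (c / β₀) ^ 2 * (5 * z32 * z72 - 3 * z52 ^ 2) * hs
  have hα : αfac * (5 * (9 - 5 * √2) * z32 * z72 - 3 * (9 - 4 * √2) * z52 ^ 2) = 4 * z32 := by
    rw [hαfac, div_mul_cancel₀ _ hden]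
  have hfm : Measurable f := by fun_prop
  have hfi := integrable_norm_pow_mul_fermi hβ₀
  have hw : ∀ p : EuclideanSpace ℝ (Fin 3), (1 / n₀) * (Real.exp (β₀ * ‖p‖ ^ 2 / 2) + 1)⁻¹ *
      (α₁ + α₂ * (β₀ * (‖p‖ ^ 2 / 2)) + α₃ * (β₀ * ⟪p, u⟫) +
        α₄ * (β₀ * ⟪p, u⟫) ^ 2 + α₅ * (β₀ * (‖u‖ ^ 2 / 2))) =
      n₀⁻¹ * (f ‖p‖ * ((α₁ + α₅ * (β₀ * ‖u‖ ^ 2) / 2) + α₂ * β₀ / 2 * ‖p‖ ^ 2 +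
        α₃ * β₀ * ⟪p, u⟫ + α₄ * β₀ ^ 2 * ⟪p, u⟫ ^ 2)) := fun p ↦ by
    simp only [hf]
    ring
  simp_rw [hw] at hWeq
  set P : EuclideanSpace ℝ (Fin 3) → ℝ := fun p ↦
    f ‖p‖ * ((α₁ + α₅ * (β₀ * ‖u‖ ^ 2) / 2) + α₂ * β₀ / 2 * ‖p‖ ^ 2 +
      α₃ * β₀ * ⟪p, u⟫ + α₄ * β₀ ^ 2 * ⟪p, u⟫ ^ 2) with hP
  have hβc : β₀ * (c / β₀) = c := mul_div_cancel₀ c hβ₀.ne'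
  have hβc₂ : β₀ * (c / β₀ ^ 2) = c / β₀ := by field_simp
  have hP0 : ∫ p, P p = n₀ := by
    rw [hP, integral_radial_mul_quadratic hfm fun k _ ↦ hfi k, hI0, hI2, hn₀', Fintype.card_fin,
      Nat.cast_ofNat]
    have h := zeroth_moment_identity (x := β₀ * ε) (U := β₀ * ‖u‖ ^ 2) hs hα
    rw [← hα₁, ← hα₂, ← hα₄] at h
    rw [hα₅]
    linear_combination c * h +
      (α₂ / 2 + α₄ * (β₀ * ‖u‖ ^ 2) / 3) * (3 * (1 - √2 / 4) * z52) * hβc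
  have hP1 : ∀ k, ∫ p : EuclideanSpace ℝ (Fin 3), p k * P p = n₀ * u k := fun k ↦ by
    have h := integral_inner_mul_radial_mul_quadratic hfm (fun k _ ↦ hfi k) u
      (EuclideanSpace.single k 1) (α₁ + α₅ * (β₀ * ‖u‖ ^ 2) / 2) (α₂ * β₀ / 2) (α₃ * β₀)
      (α₄ * β₀ ^ 2)
    simp only [EuclideanSpace.inner_single_right, conj_trivial, one_mul] at h
    rw [hP, h, hI2, hn₀', hα₃, Fintype.card_fin]
    have h3 : 3 + √2 ≠ 0 := by positivity
    field_simp
    linear_combination 12 * u k * hs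
  have hP2 : ∫ p : EuclideanSpace ℝ (Fin 3), ‖p‖ ^ 2 * P p = 2 * n₀ * (ε + ‖u‖ ^ 2 / 2) := by
    rw [hP, integral_norm_sq_mul_radial_mul_quadratic hfm fun k _ ↦ hfi k, hI2, hI4, hn₀',
      Fintype.card_fin, Nat.cast_ofNat]
    have h := second_moment_identity (x := β₀ * ε) (U := β₀ * ‖u‖ ^ 2) hs hα
    rw [← hα₁, ← hα₂, ← hα₄] at h
    rw [hα₅]
    linear_combination c / β₀ * h +
      (α₂ / 2 + α₄ * (β₀ * ‖u‖ ^ 2) / 3) * (15 * (1 - √2 / 8) * z72) * hβc₂ +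
      (2 * ε + ‖u‖ ^ 2) * ((1 - √2 / 2) * z32) * hβc
  have htr : ∀ p, (Weq p).trace = ((n₀⁻¹ * P p : ℝ) : ℂ) * ρ.trace := fun p ↦ by
    rw [hWeq, trace_smul, smul_eq_mul]
  refine ⟨fun i j ↦ ?_, fun k ↦ ?_, ?_⟩
  · have h : ∀ p, Weq p i j = ((n₀⁻¹ * P p : ℝ) : ℂ) * ρ i j := fun p ↦ by
      rw [hWeq, Matrix.smul_apply, smul_eq_mul]
    simp_rw [h]
    rw [integral_mul_const, integral_complex_ofReal, integral_const_mul, hP0,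
      inv_mul_cancel₀ hn₀_ne, Complex.ofReal_one, one_mul]
  · have h : ∀ p : EuclideanSpace ℝ (Fin 3), (p k : ℂ) * (Weq p).trace =
        ((n₀⁻¹ * (p k * P p) : ℝ) : ℂ) * ρ.trace := fun p ↦ by
      rw [htr]
      push_cast
      ring
    simp_rw [h]
    rw [integral_mul_const, integral_complex_ofReal, integral_const_mul, hP1,
      inv_mul_cancel_left₀ hn₀_ne, mul_comm]
  · have h : ∀ p : EuclideanSpace ℝ (Fin 3), ((‖p‖ ^ 2 / 2 : ℝ) : ℂ) * (Weq p).trace =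
        ((n₀⁻¹ / 2 * (‖p‖ ^ 2 * P p) : ℝ) : ℂ) * ρ.trace := fun p ↦ by
      rw [htr]
      push_cast
      ring
    simp_rw [h]
    rw [integral_mul_const, integral_complex_ofReal, integral_const_mul, hP2, mul_comm]
    congr 2
    field_simp
end
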